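/- Let R ≥ 1 be an integer and let z, z_1, z_2 ∈ ℤ. Then: (i) int_R(−z) = −int_R(z); (ii) int_R(z_1 + z_2) is one of int_R(z_1) + int_R(z_2) − 1, int_R(z_1) + int_R(z_2), or int_R(z_1) + int_R(z_2) + 1; (iii) if at least one of int_R(z_1), int_R(z_2) is even, then int_R(z_1 + z_2) = int_R(z_1) + int_R(z_2). -/

import Mathlib

/-- For an integer `R ≥ 1`, the `R`-interval function: `intR R z = 2k` if `z = kR`;
`intR R z = 2k + 1` if `kR < z < (k+1)R` with `k ≥ 0`; and `intR R z = -(2k+1)` if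
`-(k+1)R < z < -kR` with `k ≥ 0`.  (For `R ≥ 1` this is computed by the closed
formula below, using floor division.) -/
def intR (R z : ℤ) : ℤ :=
  if R ∣ z then 2 * Int.fdiv z R else 2 * Int.fdiv z R + 1

theorem intR_mul {R : ℤ} (hR : 0 < R) (k : ℤ) : intR R (R * k) = 2 * k := by
  rw [intR, if_pos (dvd_mul_right R k), Int.fdiv_eq_ediv_of_nonneg _ hR.le,
    Int.mul_ediv_cancel_left _ hR.ne']

theorem intR_mul_add {R r : ℤ} (k : ℤ) (hr : 0 < r) (hrR : r < R) :
    intR R (R * k + r) = 2 * k + 1 := by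
  have hR : 0 < R := hr.trans hrR
  have hdvd : ¬ R ∣ R * k + r := fun h =>
    hrR.not_ge (Int.le_of_dvd hr ((dvd_add_right (dvd_mul_right R k)).1 h))
  rw [intR, if_neg hdvd, Int.fdiv_eq_ediv_of_nonneg _ hR.le, Int.mul_add_ediv_left _ _ hR.ne',
    Int.ediv_eq_zero_of_lt hr.le hrR, add_zero]

theorem exists_eq_mul_or_eq_mul_add {R : ℤ} (hR : 0 < R) (z : ℤ) :
    ∃ k, z = R * k ∨ ∃ r, 0 < r ∧ r < R ∧ z = R * k + r := by
  refine ⟨z / R, ?_⟩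
  have h := Int.mul_ediv_add_emod z R
  rcases (Int.emod_nonneg z hR.ne').eq_or_lt with h0 | h0
  · left
    omega
  · exact Or.inr ⟨z % R, h0, Int.emod_lt_of_pos z hR, h.symm⟩

theorem intR_neg {R : ℤ} (hR : 0 < R) (z : ℤ) : intR R (-z) = -intR R z := by
  obtain ⟨k, rfl | ⟨r, hr, hrR, rfl⟩⟩ := exists_eq_mul_or_eq_mul_add hR z
  · rw [← mul_neg, intR_mul hR, intR_mul hR, mul_neg]
  · rw [show -(R * k + r) = R * (-k - 1) + (R - r) by ring,
      intR_mul_add _ (by omega) (by omega), intR_mul_add _ hr hrR]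
    ring

theorem intR_mul_add_eq_add {R : ℤ} (hR : 0 < R) (k z : ℤ) :
    intR R (R * k + z) = 2 * k + intR R z := by
  obtain ⟨l, rfl | ⟨r, hr, hrR, rfl⟩⟩ := exists_eq_mul_or_eq_mul_add hR z
  · rw [← mul_add, intR_mul hR, intR_mul hR, mul_add]
  · rw [← add_assoc, ← mul_add, intR_mul_add _ hr hrR, intR_mul_add _ hr hrR]
    ring

theorem intR_add_of_even_left {R : ℤ} (hR : 0 < R) {z₁ : ℤ} (z₂ : ℤ) (h : Even (intR R z₁)) :
    intR R (z₁ + z₂) = intR R z₁ + intR R z₂ := by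
  obtain ⟨k, rfl | ⟨r, hr, hrR, rfl⟩⟩ := exists_eq_mul_or_eq_mul_add hR z₁
  · rw [intR_mul_add_eq_add hR, intR_mul hR]
  · rw [intR_mul_add _ hr hrR] at h
    exact absurd h (Int.not_even_two_mul_add_one k)

theorem intR_add_mem {R : ℤ} (hR : 0 < R) (z₁ z₂ : ℤ) :
    intR R (z₁ + z₂) = intR R z₁ + intR R z₂ - 1 ∨
      intR R (z₁ + z₂) = intR R z₁ + intR R z₂ ∨
      intR R (z₁ + z₂) = intR R z₁ + intR R z₂ + 1 := by
  obtain ⟨k, rfl | ⟨r, hr, hrR, rfl⟩⟩ := exists_eq_mul_or_eq_mul_add hR z₁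
  · rw [intR_mul_add_eq_add hR, intR_mul hR]
    simp
  obtain ⟨l, rfl | ⟨s, hs, hsR, rfl⟩⟩ := exists_eq_mul_or_eq_mul_add hR z₂
  · rw [add_comm (R * k + r), intR_mul_add_eq_add hR, intR_mul hR, add_comm (2 * l)]
    simp
  rw [intR_mul_add _ hr hrR, intR_mul_add _ hs hsR]
  rcases lt_trichotomy (r + s) R with h | h | h
  · rw [show R * k + r + (R * l + s) = R * (k + l) + (r + s) by ring,
      intR_mul_add _ (by omega) h]
    omega
  · rw [show R * k + r + (R * l + s) = R * (k + l) + (r + s) by ring, h,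
      show R * (k + l) + R = R * (k + l + 1) by ring, intR_mul hR]
    omega
  · rw [show R * k + r + (R * l + s) = R * (k + l + 1) + (r + s - R) by ring,
      intR_mul_add _ (by omega) (by omega)]
    omega

/-- Elementary properties of the `R`-interval function: it commutes with negation,
it is additive up to an error of at most `1`, and it is additive whenever one of
the two inputs has even `R`-interval. -/
theorem intR_properties (R : ℤ) (hR : 1 ≤ R) (z z₁ z₂ : ℤ) :
    intR R (-z) = -intR R z ∧
    (intR R (z₁ + z₂) = intR R z₁ + intR R z₂ - 1 ∨
      intR R (z₁ + z₂) = intR R z₁ + intR R z₂ ∨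
      intR R (z₁ + z₂) = intR R z₁ + intR R z₂ + 1) ∧
    ((Even (intR R z₁) ∨ Even (intR R z₂)) →
      intR R (z₁ + z₂) = intR R z₁ + intR R z₂) := by
  have hR₀ : 0 < R := by omega
  refine ⟨intR_neg hR₀ z, intR_add_mem hR₀ z₁ z₂, ?_⟩
  rintro (h | h)
  · exact intR_add_of_even_left hR₀ z₂ h
  · rw [add_comm z₁, add_comm (intR R z₁)]
    exact intR_add_of_even_left hR₀ z₁ h
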